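/- arXiv:2401.12775 — 5 statements merged into one kernel-verified Lean document; each statement's English description precedes it below -/
import Mathlib

section
/- Let p be an odd prime and let g : ℤ_p → ℚ_p be continuous. Then the sequence N ↦ Σ_{a=0}^{p^N−1} (−1)^a g(a) converges in ℚ_p; that is, the fermionic integral ∫_{ℤ_p} g(a) dμ_{−1}(a) exists. -/
open Filter Topology

namespace PZeta

variable (p : ℕ) [Fact p.Prime]

/-- The `N`-th partial sum defining the fermionic integral
`∫_{ℤ_p} g dμ₋₁ = lim_N Σ_{a=0}^{p^N-1} (-1)^a g(a)`. -/
noncomputable def fermSum (g : ℤ_[p] → ℚ_[p]) (N : ℕ) : ℚ_[p] :=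
  ∑ a ∈ Finset.range (p ^ N), (-1 : ℚ_[p]) ^ a * g (a : ℤ_[p])

/-- The `N`-th partial sum defining the Volkenborn integral
`∫_{ℤ_p} g da = lim_N p^{-N} Σ_{a=0}^{p^N-1} g(a)`. -/
noncomputable def volkSum (g : ℤ_[p] → ℚ_[p]) (N : ℕ) : ℚ_[p] :=
  ((p : ℚ_[p]) ^ N)⁻¹ * ∑ a ∈ Finset.range (p ^ N), g (a : ℤ_[p])

/-- The unit part `x·p^{-v_p(x)}` of a nonzero `p`-adic number. -/
noncomputable def unitPart (x : ℚ_[p]) : ℚ_[p] := x * (p : ℚ_[p]) ^ (-x.valuation)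

/-- The Teichmüller representative of a `p`-adic unit, `lim_n x^{p^n}`. -/
noncomputable def teich (x : ℚ_[p]) : ℚ_[p] :=
  limUnder atTop fun n : ℕ => x ^ p ^ n

/-- The projection `⟨x⟩ ∈ 1 + pℤ_p`, via `x = p^{v_p(x)}·ζ·⟨x⟩`. -/
noncomputable def angle (x : ℚ_[p]) : ℚ_[p] := unitPart p x / teich p (unitPart p x)

/-- `ω_v(x) := x / ⟨x⟩ = p^{v_p(x)}·ζ`. -/
noncomputable def omegaV (x : ℚ_[p]) : ℚ_[p] := x / angle p x

/-- The generalized binomial coefficient `C(t,n) = t(t-1)⋯(t-n+1)/n!`. -/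
noncomputable def gbinom (t : ℚ_[p]) (n : ℕ) : ℚ_[p] :=
  (∏ i ∈ Finset.range n, (t - (i : ℚ_[p]))) / (n.factorial : ℚ_[p])

/-- The power `y^t` defined by the binomial series `Σ_n C(t,n)(y-1)^n`
(used for `y ∈ 1 + pℤ_p` and `t ∈ ℤ_p`). -/
noncomputable def bpow (y t : ℚ_[p]) : ℚ_[p] := ∑' n : ℕ, gbinom p t n * (y - 1) ^ n

/-- The Iwasawa `p`-adic logarithm: `log_p x = Σ_{n≥1} (-1)^{n+1}(⟨x⟩-1)^n/n`
(one has `log_p p = 0` and `log_p ζ = 0` for roots of unity of order prime to `p`). -/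
noncomputable def padicLog (x : ℚ_[p]) : ℚ_[p] :=
  ∑' n : ℕ, (-1 : ℚ_[p]) ^ n * (angle p x - 1) ^ (n + 1) / ((n : ℚ_[p]) + 1)

/-- The power `y^t` defined by the exponential series `Σ_n (t·log_p y)^n/n!`
(used for `y ∈ 1 + pℤ_p` and `‖t‖ < p^{(p-2)/(p-1)}`). -/
noncomputable def epow (y t : ℚ_[p]) : ℚ_[p] :=
  ∑' n : ℕ, (t * padicLog p y) ^ n / (n.factorial : ℚ_[p])

/-- `f : ℤ_p → ℤ_p` is everywhere analytic with integral coefficients: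
`f(x) = Σ_k c_k x^k` with `‖c_k‖ ≤ 1`, `c_k → 0`. -/
def EverywhereAnalytic (f : ℤ_[p] → ℤ_[p]) : Prop :=
  ∃ c : ℕ → ℚ_[p], (∀ k, ‖c k‖ ≤ 1) ∧ Tendsto c atTop (𝓝 0) ∧
    ∀ x : ℤ_[p], (f x : ℚ_[p]) = ∑' k : ℕ, c k * (x : ℚ_[p]) ^ k

/-- The `p`-adic Hurwitz-type Euler zeta function w.r.t. `f`:
`ζ_{p,E}^f(s,λ) = ∫_{ℤ_p} ⟨λ+f(a)⟩^{1-s} dμ₋₁(a)`. -/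
noncomputable def zetaE (f : ℤ_[p] → ℤ_[p]) (s : ℤ_[p]) (lam : ℚ_[p]) : ℚ_[p] :=
  limUnder atTop
    (fermSum p fun a => bpow p (angle p (lam + (f a : ℚ_[p]))) (1 - (s : ℚ_[p])))

/-- The `p`-adic Hurwitz zeta function w.r.t. `f`:
`ζ_p^f(s,λ) = (s-1)⁻¹ ∫_{ℤ_p} ⟨λ+f(a)⟩^{1-s} da`. -/
noncomputable def zetaH (f : ℤ_[p] → ℤ_[p]) (s : ℤ_[p]) (lam : ℚ_[p]) : ℚ_[p] :=
  ((s : ℚ_[p]) - 1)⁻¹ *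
    limUnder atTop
      (volkSum p fun a => bpow p (angle p (lam + (f a : ℚ_[p]))) (1 - (s : ℚ_[p])))

end PZeta

open PZeta

/-- If `g` is almost invariant under translation by multiples of the odd number `m`, then its
alternating sum over `k` consecutive blocks of length `m` is close to an alternating sum of
copies of the first block. -/
theorem norm_alternating_sum_mul_sub_le {p : ℕ} [Fact p.Prime] {m : ℕ} (hm : Odd m)
    (g : ℕ → ℚ_[p]) {ε : ℝ} (hε : 0 ≤ ε) (hg : ∀ k a, ‖g (m * k + a) - g a‖ ≤ ε) (k : ℕ) :
    ‖∑ a ∈ Finset.range (m * k), (-1 : ℚ_[p]) ^ a * g a -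
      (∑ j ∈ Finset.range k, (-1 : ℚ_[p]) ^ j) *
        ∑ a ∈ Finset.range m, (-1 : ℚ_[p]) ^ a * g a‖ ≤ ε := by
  induction k with
  | zero => simpa using hε
  | succ k ih =>
    have hblock : ‖∑ a ∈ Finset.range m, (-1 : ℚ_[p]) ^ (k + a) * (g (m * k + a) - g a)‖ ≤ ε :=
      IsUltrametricDist.norm_sum_le_of_forall_le_of_nonneg hε fun a _ ↦ by
        simpa using hg k a
    refine le_trans (le_of_eq ?_)
      ((IsUltrametricDist.norm_add_le_max _ _).trans (max_le ih hblock))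
    congr 1
    rw [Nat.mul_succ, Finset.sum_range_add, Finset.sum_range_succ]
    simp only [pow_add, pow_mul, hm.neg_one_pow, mul_sub, Finset.sum_sub_distrib, add_mul,
      mul_assoc, ← Finset.mul_sum]
    ring

theorem norm_fermSum_succ_sub_le {p : ℕ} [Fact p.Prime] (hp : Odd p) (g : ℤ_[p] → ℚ_[p]) {N : ℕ}
    {ε : ℝ} (hε : 0 ≤ ε)
    (hg : ∀ x y : ℤ_[p], ‖x - y‖ ≤ (p : ℝ) ^ (-N : ℤ) → ‖g x - g y‖ ≤ ε) :
    ‖fermSum p g (N + 1) - fermSum p g N‖ ≤ ε := by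
  have h := norm_alternating_sum_mul_sub_le (hp.pow (n := N)) (fun a ↦ g a) hε
    (fun k a ↦ hg _ _ ?_) p
  · simpa [fermSum, pow_succ, neg_one_geom_sum, Nat.not_even_iff_odd.2 hp] using h
  · rw [PadicInt.norm_le_pow_iff_mem_span_pow, Ideal.mem_span_singleton]
    exact ⟨k, by push_cast; ring⟩

/-- for an odd prime `p` and continuous `g : ℤ_p → ℚ_p`, the fermionic
integral `∫_{ℤ_p} g(a) dμ₋₁(a)` exists, i.e. `N ↦ Σ_{a=0}^{p^N-1} (-1)^a g(a)` converges. -/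
theorem fermionic_integral_exists (p : ℕ) [Fact p.Prime] (hp : Odd p)
    (g : ℤ_[p] → ℚ_[p]) (hg : Continuous g) :
    ∃ L : ℚ_[p], Filter.Tendsto (fermSum p g) Filter.atTop (nhds L) := by
  refine cauchySeq_tendsto_of_complete
    (NonarchimedeanAddGroup.cauchySeq_of_tendsto_sub_nhds_zero ?_)
  rw [NormedAddGroup.tendsto_nhds_zero]
  intro ε hε
  obtain ⟨δ, hδ, hgδ⟩ := Metric.uniformContinuous_iff.1
    (CompactSpace.uniformContinuous_of_continuous hg) (ε / 2) (half_pos hε)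
  obtain ⟨M, hM⟩ := PadicInt.exists_pow_neg_lt p hδ
  filter_upwards [Filter.eventually_ge_atTop M] with N hN
  refine (norm_fermSum_succ_sub_le hp g (half_pos hε).le fun x y hxy ↦ ?_).trans_lt
    (half_lt_self hε)
  rw [← dist_eq_norm] at hxy ⊢
  refine (hgδ (hxy.trans_lt (lt_of_le_of_lt ?_ hM))).le
  exact zpow_le_zpow_right₀ (mod_cast (Fact.out : p.Prime).one_le) (by lia)
end

section
/- Let p be a prime, λ ∈ ℚ_p and m ∈ ℕ. Then the Volkenborn integral ∫_{ℤ_p} (λ+a)^m da exists, i.e. the sequence N ↦ p^{−N} Σ_{a=0}^{p^N−1} (λ+a)^m converges in ℚ_p, and its limit equals B_m(λ), the value at λ of the m-th Bernoulli polynomial. -/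
open Filter Topology

open PZeta

/-- The difference equation for Bernoulli polynomials, evaluated in a `ℚ`-algebra. -/
theorem Polynomial.aeval_bernoulli_succ_add_one {A : Type*} [CommRing A] [Algebra ℚ A]
    (n : ℕ) (x : A) :
    aeval (x + 1) (bernoulli (n + 1)) = aeval x (bernoulli (n + 1)) + (n + 1) * x ^ n := by
  have h := congrArg (aeval x) (bernoulli_comp_one_add_X (n + 1))
  simpa [aeval_comp, add_comm (1 : A) x, nsmul_eq_mul] using h

/-- Power sums over a shifted range, as a difference of Bernoulli polynomial values. -/
theorem Polynomial.succ_mul_sum_range_add_pow {A : Type*} [CommRing A] [Algebra ℚ A]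
    (m n : ℕ) (x : A) :
    ((m : A) + 1) * ∑ a ∈ Finset.range n, (x + a) ^ m =
      aeval (x + n) (bernoulli (m + 1)) - aeval x (bernoulli (m + 1)) := by
  induction n with
  | zero => simp
  | succ n ih =>
    rw [Finset.sum_range_succ, mul_add, ih, Nat.cast_succ, ← add_assoc,
      aeval_bernoulli_succ_add_one]
    ring

/-- for a prime `p`, `λ ∈ ℚ_p`, `m ∈ ℕ`, the Volkenborn integral
`∫_{ℤ_p} (λ+a)^m da` exists and equals `B_m(λ)`, the `m`-th Bernoulli polynomial at `λ`. -/
theorem volkenborn_integral_eq_bernoulli (p : ℕ) [Fact p.Prime] (lam : ℚ_[p]) (m : ℕ) :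
    Filter.Tendsto (volkSum p fun a => (lam + (a : ℚ_[p])) ^ m) Filter.atTop
      (nhds (Polynomial.aeval lam (Polynomial.bernoulli m))) := by
  have hp : (p : ℚ_[p]) ≠ 0 := Nat.cast_ne_zero.mpr (Fact.out : p.Prime).ne_zero
  have hm : (m : ℚ_[p]) + 1 ≠ 0 := Nat.cast_add_one_ne_zero m
  have hder : HasDerivAt (fun x : ℚ_[p] => Polynomial.aeval x (Polynomial.bernoulli (m + 1)))
      (((m : ℚ_[p]) + 1) * Polynomial.aeval lam (Polynomial.bernoulli m)) lam := by
    have h := (Polynomial.bernoulli (m + 1)).hasDerivAt_aeval lam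
    simpa [Polynomial.derivative_bernoulli_add_one] using h
  have hpow : Tendsto (fun N : ℕ => (p : ℚ_[p]) ^ N) atTop (𝓝[≠] 0) :=
    tendsto_nhdsWithin_iff.mpr
      ⟨tendsto_pow_atTop_nhds_zero_of_norm_lt_one Padic.norm_p_lt_one,
        Eventually.of_forall fun N => pow_ne_zero N hp⟩
  have hlim := ((hasDerivAt_iff_tendsto_slope_zero.mp hder).comp hpow).const_mul
    ((m : ℚ_[p]) + 1)⁻¹
  rw [inv_mul_cancel_left₀ hm] at hlim
  refine hlim.congr fun N => ?_
  have hsum := Polynomial.succ_mul_sum_range_add_pow m (p ^ N) lam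
  push_cast at hsum
  simp only [volkSum, Function.comp_apply, smul_eq_mul, PadicInt.coe_natCast]
  rw [← hsum, mul_left_comm, inv_mul_cancel_left₀ hm]
end

section
/- Let p be an odd prime and λ ∈ ℚ_p. For every m ∈ ℕ the fermionic integral e_m := ∫_{ℤ_p} (λ+a)^m dμ_{−1}(a) = lim_{N→∞} Σ_{a=0}^{p^N−1} (−1)^a (λ+a)^m exists in ℚ_p, and these values satisfy, for every n ∈ ℕ, the relation Σ_{k=0}^{n} binom(n,k)·e_k + e_n = 2λ^n; consequently e_m = E_m(λ), the value at λ of the m-th Euler polynomial. -/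
open Filter Topology

open PZeta

namespace PZeta

variable (p : ℕ) [Fact p.Prime]

theorem fermSum_add_pow (lam : ℚ_[p]) (m N : ℕ) :
    fermSum p (fun a => (lam + (a : ℚ_[p])) ^ m) N
      = ∑ a ∈ Finset.range (p ^ N), (-1 : ℚ_[p]) ^ a * (lam + a) ^ m := by
  simp [fermSum]

theorem sum_range_neg_one_pow_mul_add_succ {R : Type*} [CommRing R] (f : ℕ → R) (M : ℕ) :
    ∑ a ∈ Finset.range M, (-1 : R) ^ a * (f (a + 1) + f a) = f 0 - (-1) ^ M * f M := by
  induction M with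
  | zero => simp
  | succ M ih => rw [Finset.sum_range_succ, ih]; ring

theorem sum_choose_mul_fermSum_add (hp : Odd p) (lam : ℚ_[p]) (n N : ℕ) :
    (∑ k ∈ Finset.range (n + 1),
        (n.choose k : ℚ_[p]) * fermSum p (fun a => (lam + (a : ℚ_[p])) ^ k) N)
      + fermSum p (fun a => (lam + (a : ℚ_[p])) ^ n) N
      = lam ^ n + (lam + (p : ℚ_[p]) ^ N) ^ n := by
  have h := sum_range_neg_one_pow_mul_add_succ (fun a : ℕ => (lam + (a : ℚ_[p])) ^ n) (p ^ N)
  rw [hp.pow.neg_one_pow] at h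
  simp only [fermSum_add_pow, Finset.mul_sum]
  rw [Finset.sum_comm, ← Finset.sum_add_distrib]
  convert h using 1
  · refine Finset.sum_congr rfl fun a _ => ?_
    rw [Nat.cast_succ, ← add_assoc, add_pow (lam + (a : ℚ_[p])) 1 n, mul_add, Finset.mul_sum]
    congr 1
    refine Finset.sum_congr rfl fun k _ => ?_
    ring
  · push_cast
    ring

theorem tendsto_pow_add_add_prime_pow_pow (lam : ℚ_[p]) (n : ℕ) :
    Tendsto (fun N : ℕ => lam ^ n + (lam + (p : ℚ_[p]) ^ N) ^ n) atTop (𝓝 (2 * lam ^ n)) := by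
  have h : Tendsto (fun N : ℕ => (p : ℚ_[p]) ^ N) atTop (𝓝 0) :=
    tendsto_pow_atTop_nhds_zero_of_norm_lt_one Padic.norm_p_lt_one
  simpa [two_mul] using ((h.const_add lam).pow n).const_add (lam ^ n)

theorem exists_tendsto_fermSum_add_pow (hp : Odd p) (lam : ℚ_[p]) (m : ℕ) :
    ∃ l, Tendsto (fermSum p fun a => (lam + (a : ℚ_[p])) ^ m) atTop (𝓝 l) := by
  induction m using Nat.strong_induction_on with
  | _ m ih =>
    choose! l hl using ih
    refine ⟨_, (((tendsto_pow_add_add_prime_pow_pow p lam m).sub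
      (tendsto_finsetSum (Finset.range m) fun k hk =>
        (hl k (Finset.mem_range.1 hk)).const_mul (m.choose k : ℚ_[p]))).div_const 2).congr
      fun N => ?_⟩
    have h := sum_choose_mul_fermSum_add p hp lam m N
    rw [Finset.sum_range_succ, Nat.choose_self, Nat.cast_one] at h
    linear_combination -h / 2

end PZeta

/-- for an odd prime `p` and `λ ∈ ℚ_p`, the fermionic integrals
`e_m = ∫_{ℤ_p} (λ+a)^m dμ₋₁(a)` all exist, and satisfy
`Σ_{k=0}^n binom(n,k) e_k + e_n = 2λ^n` for all `n`; these relations characterize the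
Euler polynomials, so `e_m = E_m(λ)`. -/
theorem fermionic_integral_eq_euler (p : ℕ) [Fact p.Prime] (hp : Odd p) (lam : ℚ_[p]) :
    ∃ e : ℕ → ℚ_[p],
      (∀ m : ℕ, Filter.Tendsto (fermSum p fun a => (lam + (a : ℚ_[p])) ^ m)
        Filter.atTop (nhds (e m))) ∧
      (∀ n : ℕ, (∑ k ∈ Finset.range (n + 1), (n.choose k : ℚ_[p]) * e k) + e n
          = 2 * lam ^ n) := by
  choose e he using exists_tendsto_fermSum_add_pow p hp lam
  refine ⟨e, he, fun n => tendsto_nhds_unique ?_ (tendsto_pow_add_add_prime_pow_pow p lam n)⟩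
  exact ((tendsto_finsetSum _ fun k _ => (he k).const_mul (n.choose k : ℚ_[p])).add
    (he n)).congr (sum_choose_mul_fermSum_add p hp lam n)
end

section
/- Let p be a prime and λ : ℕ → ℚ_p a sequence, and set c_n := Σ_{i=0}^{n} (−1)^{n−i}·binom(n,i)·λ_i. Suppose there is a real number r with 0 < r < p^{−1/(p−1)} such that ‖c_n‖_p·r^{−n} → 0 as n → ∞. Then there exist a real number ρ > 1 and a sequence (a_k) in ℚ_p with ‖a_k‖_p·ρ^k → 0 such that the power series A(x) = Σ_{k=0}^∞ a_k x^k converges for every x ∈ ℚ_p with ‖x‖_p ≤ 1, satisfies A(n) = λ_n for every n ∈ ℕ, and satisfies A(ξ) = Σ_{n=0}^∞ c_n·C(ξ,n) for every ξ ∈ ℤ_p, where the latter series converges. -/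
open Filter Topology

open PZeta

/-- Lower bound `p^{-n/(p-1)} ≤ ‖n!‖` coming from Legendre's formula. -/
theorem rpow_pow_le_norm_factorial (p : ℕ) [Fact p.Prime] (n : ℕ) :
    ((p : ℝ) ^ (-(1 : ℝ) / ((p : ℝ) - 1))) ^ n ≤ ‖(n.factorial : ℚ_[p])‖ := by
  have hp : 1 < (p : ℝ) := mod_cast (Fact.out : p.Prime).one_lt
  have hp' : 0 < (p : ℝ) - 1 := sub_pos.2 hp
  have hn : (n.factorial : ℚ_[p]) ≠ 0 := mod_cast n.factorial_ne_zero
  rw [Padic.norm_eq_zpow_neg_valuation hn, Padic.valuation_natCast, ← Real.rpow_natCast,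
    ← Real.rpow_mul (by positivity), ← Real.rpow_intCast]
  refine Real.rpow_le_rpow_of_exponent_le hp.le ?_
  have legendre : ((p : ℝ) - 1) * padicValNat p n.factorial ≤ n := by
    have h : (p - 1) * padicValNat p n.factorial ≤ n :=
      (sub_one_mul_padicValNat_factorial n).trans_le (Nat.sub_le _ _)
    rw [← Nat.cast_pred (Fact.out : p.Prime).pos]
    exact_mod_cast h
  rw [Int.cast_neg, Int.cast_natCast, div_mul_eq_mul_div, div_le_iff₀ hp']
  linarith

theorem norm_descPochhammer_coeff_le_one (p : ℕ) [Fact p.Prime] (n k : ℕ) :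
    ‖(descPochhammer ℚ_[p] n).coeff k‖ ≤ 1 := by
  rw [← descPochhammer_map (Int.castRingHom ℚ_[p]), Polynomial.coeff_map, eq_intCast]
  exact Padic.norm_int_le_one _

theorem gbinom_eq_sum_coeff (p : ℕ) [Fact p.Prime] (x : ℚ_[p]) (n : ℕ) :
    gbinom p x n = ∑ k ∈ Finset.range (n + 1),
      (descPochhammer ℚ_[p] n).coeff k * x ^ k / (n.factorial : ℚ_[p]) := by
  rw [gbinom, ← Finset.sum_div]
  congr 1
  trans (descPochhammer ℚ_[p] n).eval x
  · induction n with
    | zero => simp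
    | succ n ih => rw [Finset.prod_range_succ, descPochhammer_succ_eval, ih]
  · rw [Polynomial.eval_eq_sum_range, descPochhammer_natDegree]

theorem gbinom_natCast (p : ℕ) [Fact p.Prime] (m n : ℕ) :
    gbinom p (m : ℚ_[p]) n = (m.choose n : ℚ_[p]) := by
  rw [gbinom, div_eq_iff (mod_cast n.factorial_ne_zero), ← Nat.cast_mul, mul_comm,
    ← Nat.descFactorial_eq_factorial_mul_choose, ← descPochhammer_eval_eq_descFactorial]
  induction n with
  | zero => simp
  | succ n ih => rw [Finset.prod_range_succ, descPochhammer_succ_eval, ih]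

/-- Newton's formula: a sequence is recovered from its iterated differences at `0`. -/
theorem sum_choose_mul_alternating_sum {R : Type*} [CommRing R] (u c : ℕ → R)
    (hc : ∀ n : ℕ, c n = ∑ i ∈ Finset.range (n + 1), (-1 : R) ^ (n - i) * (n.choose i : R) * u i)
    (n : ℕ) : ∑ k ∈ Finset.range (n + 1), c k * (n.choose k : R) = u n := by
  have hdiff (k : ℕ) : c k = (fwdDiff 1)^[k] u 0 := by
    rw [hc, fwdDiff_iter_eq_sum_shift]
    simp [zsmul_eq_mul]
  have h := shift_eq_sum_fwdDiff_iter 1 u n 0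
  simp only [zero_add, smul_eq_mul, mul_one] at h
  rw [h]
  exact Finset.sum_congr rfl fun k _ => by rw [hdiff, nsmul_eq_mul, mul_comm]

/-- A lower triangular double family whose rows tend uniformly to `0` is summable. -/
theorem summable_uncurry_of_norm_le {E : Type*} [NormedAddCommGroup E] [IsUltrametricDist E]
    [CompleteSpace E] {f : ℕ → ℕ → E} {g : ℕ → ℝ} (hg : Tendsto g atTop (𝓝 0))
    (hfg : ∀ n k, ‖f n k‖ ≤ g n) (hf : ∀ n k, n < k → f n k = 0) :
    Summable (Function.uncurry f) := by
  refine NonarchimedeanAddGroup.summable_of_tendsto_cofinite_zero ?_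
  rw [NormedAddGroup.tendsto_nhds_zero]
  intro ε hε
  obtain ⟨N, hN⟩ := eventually_atTop.1 (hg.eventually_lt_const hε)
  refine Set.Finite.subset (Finset.finite_toSet (Finset.range N ×ˢ Finset.range N)) ?_
  rintro ⟨n, k⟩ h
  have h' : ε ≤ ‖f n k‖ := not_lt.1 h
  have hn : n < N := by
    by_contra! hn
    exact (hN n hn).not_ge (h'.trans (hfg n k))
  have hk : k ≤ n := by
    by_contra! hk
    rw [hf n k hk, norm_zero] at h'
    exact hε.not_ge h'
  simp [hn, hk.trans_lt hn]

theorem norm_tsum_le_of_forall_norm_le {ι E : Type*} [NormedAddCommGroup E] [IsUltrametricDist E]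
    {f : ι → E} {C : ℝ} (hC : 0 ≤ C) (h : ∀ i, ‖f i‖ ≤ C) : ‖∑' i, f i‖ ≤ C := by
  by_cases hf : Summable f
  · exact le_of_tendsto hf.hasSum.norm (.of_forall fun s =>
      IsUltrametricDist.norm_sum_le_of_forall_le_of_nonneg hC fun i _ => h i)
  · rwa [tsum_eq_zero_of_not_summable hf, norm_zero]


/-- Iwasawa's interpolation criterion. If `c_n = Σ_i (-1)^{n-i} binom(n,i) λ_i`
satisfies `‖c_n‖ r^{-n} → 0` for some `0 < r < p^{-1/(p-1)}`, then there is a power series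
`A(x) = Σ_k a_k x^k` with radius of convergence `ρ > 1` (i.e. `‖a_k‖ ρ^k → 0`), converging on
the closed unit disc, with `A(n) = λ_n` for all `n`, and `A(ξ) = Σ_n c_n C(ξ,n)` on `ℤ_p`. -/
theorem iwasawa_interpolation (p : ℕ) [Fact p.Prime] (lam : ℕ → ℚ_[p]) (c : ℕ → ℚ_[p])
    (hc : ∀ n : ℕ, c n = ∑ i ∈ Finset.range (n + 1),
      (-1 : ℚ_[p]) ^ (n - i) * (n.choose i : ℚ_[p]) * lam i)
    (hr : ∃ r : ℝ, 0 < r ∧ r < (p : ℝ) ^ (-(1 : ℝ) / ((p : ℝ) - 1)) ∧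
      Filter.Tendsto (fun n : ℕ => ‖c n‖ * r⁻¹ ^ n) Filter.atTop (nhds 0)) :
    ∃ (ρ : ℝ) (a : ℕ → ℚ_[p]), 1 < ρ ∧
      Filter.Tendsto (fun k : ℕ => ‖a k‖ * ρ ^ k) Filter.atTop (nhds 0) ∧
      (∀ x : ℚ_[p], ‖x‖ ≤ 1 → Summable (fun k : ℕ => a k * x ^ k)) ∧
      (∀ n : ℕ, (∑' k : ℕ, a k * (n : ℚ_[p]) ^ k) = lam n) ∧
      (∀ ξ : ℤ_[p], Summable (fun n : ℕ => c n * gbinom p (ξ : ℚ_[p]) n) ∧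
        (∑' k : ℕ, a k * (ξ : ℚ_[p]) ^ k) = ∑' n : ℕ, c n * gbinom p (ξ : ℚ_[p]) n) := by
  obtain ⟨r, hr0, hrs, hcr⟩ := hr
  set s : ℝ := (p : ℝ) ^ (-(1 : ℝ) / ((p : ℝ) - 1))
  have hs0 : 0 < s := hr0.trans hrs
  have hρ : 1 < s / r := (one_lt_div hr0).2 hrs
  have hρ0 : 0 < s / r := one_pos.trans hρ
  set d : ℕ → ℕ → ℚ_[p] := fun n k =>
    c n * ((descPochhammer ℚ_[p] n).coeff k / (n.factorial : ℚ_[p])) with hd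
  have hd_zero (n k : ℕ) (h : n < k) : d n k = 0 := by
    have : (descPochhammer ℚ_[p] n).coeff k = 0 :=
      Polynomial.coeff_eq_zero_of_natDegree_lt (by rwa [descPochhammer_natDegree])
    simp [hd, this]
  have hd_le (n k : ℕ) : ‖d n k‖ * (s / r) ^ n ≤ ‖c n‖ * r⁻¹ ^ n := by
    have h1 : ‖(descPochhammer ℚ_[p] n).coeff k‖ * s ^ n ≤ ‖(n.factorial : ℚ_[p])‖ :=
      (mul_le_of_le_one_left (by positivity) (norm_descPochhammer_coeff_le_one p n k)).trans
        (rpow_pow_le_norm_factorial p n)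
    have h2 : 0 < ‖(n.factorial : ℚ_[p])‖ := norm_pos_iff.2 (mod_cast n.factorial_ne_zero)
    calc ‖d n k‖ * (s / r) ^ n
        = ‖c n‖ * r⁻¹ ^ n *
          (‖(descPochhammer ℚ_[p] n).coeff k‖ * s ^ n / ‖(n.factorial : ℚ_[p])‖) := by
          rw [hd, norm_mul, norm_div, div_eq_mul_inv s r, mul_pow]
          ring
      _ ≤ ‖c n‖ * r⁻¹ ^ n :=
          mul_le_of_le_one_right (by positivity) ((div_le_one h2).2 h1)
  have hsum (x : ℚ_[p]) (hx : ‖x‖ ≤ 1) :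
      Summable (Function.uncurry fun n k => d n k * x ^ k) := by
    refine summable_uncurry_of_norm_le hcr (fun n k => ?_) fun n k h => by simp [hd_zero n k h]
    calc ‖d n k * x ^ k‖ = ‖d n k‖ * ‖x‖ ^ k := by rw [norm_mul, norm_pow]
      _ ≤ ‖d n k‖ := mul_le_of_le_one_right (norm_nonneg _) (pow_le_one₀ (norm_nonneg _) hx)
      _ ≤ ‖d n k‖ * (s / r) ^ n := le_mul_of_one_le_right (norm_nonneg _) (one_le_pow₀ hρ.le)
      _ ≤ ‖c n‖ * r⁻¹ ^ n := hd_le n k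
  have hrow (x : ℚ_[p]) (n : ℕ) : ∑' k, d n k * x ^ k = c n * gbinom p x n := by
    rw [tsum_eq_sum (s := Finset.range (n + 1)) fun k hk => by
      rw [hd_zero n k (by simpa using hk), zero_mul], gbinom_eq_sum_coeff, Finset.mul_sum]
    exact Finset.sum_congr rfl fun k _ => by rw [hd]; ring
  have hcol (x : ℚ_[p]) (k : ℕ) : ∑' n, d n k * x ^ k = (∑' n, d n k) * x ^ k := tsum_mul_right
  have hnewton (x : ℚ_[p]) (hx : ‖x‖ ≤ 1) : Summable (fun n => c n * gbinom p x n) ∧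
      ∑' k, (∑' n, d n k) * x ^ k = ∑' n, c n * gbinom p x n := by
    constructor
    · simpa only [Function.uncurry_apply_pair, hrow] using (hsum x hx).prod
    · simp only [← hrow, ← hcol]
      exact (hsum x hx).tsum_comm
  refine ⟨s / r, fun k => ∑' n, d n k, hρ, ?_, fun x hx => ?_, fun n => ?_, fun ξ => ?_⟩
  · rw [Metric.tendsto_atTop]
    intro ε hε
    obtain ⟨N, hN⟩ := eventually_atTop.1 (hcr.eventually_lt_const (half_pos hε))
    refine ⟨N, fun k hk => ?_⟩
    have hle : ‖∑' n, d n k‖ ≤ ε / 2 / (s / r) ^ k := by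
      refine norm_tsum_le_of_forall_norm_le (by positivity) fun n => ?_
      obtain h | h := lt_or_ge n k
      · rw [hd_zero n k h, norm_zero]
        positivity
      · rw [le_div_iff₀ (by positivity)]
        calc ‖d n k‖ * (s / r) ^ k ≤ ‖d n k‖ * (s / r) ^ n := by
              gcongr
              exact hρ.le
          _ ≤ ‖c n‖ * r⁻¹ ^ n := hd_le n k
          _ ≤ ε / 2 := (hN n (hk.trans h)).le
    rw [Real.dist_0_eq_abs, abs_of_nonneg (by positivity)]
    exact ((le_div_iff₀ (by positivity)).1 hle).trans_lt (half_lt_self hε)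
  · simpa only [Function.uncurry_apply_pair, Prod.swap, hcol] using (hsum x hx).prod_symm.prod
  · rw [(hnewton n (mod_cast Padic.norm_int_le_one (p := p) n)).2,
      tsum_eq_sum (s := Finset.range (n + 1)) fun k hk => by
        rw [gbinom_natCast, Nat.choose_eq_zero_of_lt (by simpa using hk), Nat.cast_zero, mul_zero]]
    simp only [gbinom_natCast]
    exact sum_choose_mul_alternating_sum lam c hc n
  · exact hnewton ξ ξ.2
end

section
/- Let p be an odd prime, f : ℤ_p → ℤ_p continuous, and λ ∈ ℚ_p with ‖λ‖_p > 1. Then there exists a sequence (c_n) in ℚ_p such that for every s ∈ ℚ_p with ‖s‖_p < p^{(p−2)/(p−1)}: the fermionic integral ζ_{p,E}^f(s,λ) := ∫_{ℤ_p} ⟨λ+f(a)⟩^{1−s} dμ_{−1}(a) exists, the series Σ_{n=0}^∞ c_n s^n converges, and ζ_{p,E}^f(s,λ) = Σ_{n=0}^∞ c_n s^n; in particular s ↦ ζ_{p,E}^f(s,λ) is analytic on the disc ‖s‖_p < p^{(p−2)/(p−1)}. -/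
open Filter Topology

open PZeta

namespace PZeta

variable {p : ℕ} [Fact p.Prime]

lemma fermSum_norm_le {g : ℤ_[p] → ℚ_[p]} {C : ℝ} (hC : 0 ≤ C) (h : ∀ a, ‖g a‖ ≤ C) (N : ℕ) :
    ‖fermSum p g N‖ ≤ C :=
  IsUltrametricDist.norm_sum_le_of_forall_le_of_nonneg hC fun a _ => by simpa using h a

lemma sum_range_mul {M : Type*} [AddCommMonoid M] (F : ℕ → M) (n m : ℕ) :
    ∑ a ∈ Finset.range (n * m), F a
      = ∑ j ∈ Finset.range m, ∑ b ∈ Finset.range n, F (n * j + b) := by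
  induction m with
  | zero => simp
  | succ m ih => rw [Nat.mul_succ, Finset.sum_range_add, ih, Finset.sum_range_succ]

lemma fermSum_succ_sub (hp : Odd p) (g : ℤ_[p] → ℚ_[p]) (N : ℕ) :
    fermSum p g (N + 1) - fermSum p g N
      = ∑ j ∈ Finset.range p, ∑ b ∈ Finset.range (p ^ N),
          (-1 : ℚ_[p]) ^ (p ^ N * j + b) * (g ((p ^ N * j + b : ℕ) : ℤ_[p]) - g (b : ℤ_[p])) := by
  have h1 : fermSum p g N = ∑ j ∈ Finset.range p, ∑ b ∈ Finset.range (p ^ N),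
      (-1 : ℚ_[p]) ^ (p ^ N * j + b) * g (b : ℤ_[p]) := by
    simp_rw [pow_add, pow_mul, (hp.pow (n := N)).neg_one_pow, mul_assoc, ← Finset.mul_sum]
    rw [← Finset.sum_mul, neg_one_geom_sum, if_neg (Nat.not_even_iff_odd.mpr hp), one_mul]
    rfl
  rw [h1, fermSum, pow_succ, sum_range_mul, ← Finset.sum_sub_distrib]
  refine Finset.sum_congr rfl fun j _ => ?_
  rw [← Finset.sum_sub_distrib]
  exact Finset.sum_congr rfl fun b _ => (mul_sub _ _ _).symm

lemma exists_tendsto_fermSum (hp : Odd p) {g : ℤ_[p] → ℚ_[p]} (hg : Continuous g) :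
    ∃ I, Tendsto (fermSum p g) atTop (𝓝 I) := by
  refine cauchySeq_tendsto_of_complete
    (NonarchimedeanAddGroup.cauchySeq_of_tendsto_sub_nhds_zero ?_)
  rw [Metric.tendsto_atTop]
  intro ε hε
  obtain ⟨δ, hδ, h⟩ := Metric.uniformContinuous_iff.mp
    (CompactSpace.uniformContinuous_of_continuous hg) (ε / 2) (half_pos hε)
  obtain ⟨k, hk⟩ := PadicInt.exists_pow_neg_lt p hδ
  refine ⟨k, fun N hN => ?_⟩
  rw [dist_zero_right, fermSum_succ_sub hp]
  refine lt_of_le_of_lt ?_ (half_lt_self hε)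
  refine IsUltrametricDist.norm_sum_le_of_forall_le_of_nonneg (half_pos hε).le fun j _ =>
    IsUltrametricDist.norm_sum_le_of_forall_le_of_nonneg (half_pos hε).le fun b _ => ?_
  rw [norm_mul, norm_pow, norm_neg, norm_one, one_pow, one_mul, ← dist_eq_norm]
  refine (h ?_).le
  rw [dist_eq_norm]
  push_cast
  rw [add_sub_cancel_right, norm_mul, PadicInt.norm_p_pow]
  have hp1 : (1 : ℝ) ≤ p := by exact_mod_cast (Fact.out : p.Prime).one_lt.le
  calc (p : ℝ) ^ (-N : ℤ) * ‖(j : ℤ_[p])‖ ≤ (p : ℝ) ^ (-N : ℤ) * 1 := by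
        gcongr; exact PadicInt.norm_le_one _
    _ ≤ (p : ℝ) ^ (-k : ℤ) := by
        rw [mul_one]; exact zpow_le_zpow_right₀ hp1 (by omega)
    _ < δ := hk

lemma norm_le_inv_of_lt_one {x : ℚ_[p]} (hx : ‖x‖ < 1) : ‖x‖ ≤ (p : ℝ)⁻¹ := by
  simpa using (Padic.norm_le_pow_iff_norm_lt_pow_add_one x (-1)).mpr (by simpa using hx)

lemma inv_lt_one : (p : ℝ)⁻¹ < 1 :=
  inv_lt_one_of_one_lt₀ (by exact_mod_cast (Fact.out : p.Prime).one_lt)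

lemma norm_pow_sub_pow_le {x y : ℤ_[p]} (h : ‖x - y‖ < 1) (k : ℕ) :
    ‖x ^ p ^ k - y ^ p ^ k‖ ≤ (p : ℝ)⁻¹ ^ (k + 1) := by
  obtain ⟨z, hz⟩ := dvd_sub_pow_of_dvd_sub ((PadicInt.norm_lt_one_iff_dvd _).mp h) k
  rw [hz, norm_mul, norm_pow, PadicInt.norm_p]
  exact mul_le_of_le_one_right (by positivity) (PadicInt.norm_le_one _)

lemma norm_pow_p_sub_lt_one (x : ℤ_[p]) : ‖x ^ p - x‖ < 1 := by
  rw [← PadicInt.mem_nonunits, ← IsLocalRing.mem_maximalIdeal, ← PadicInt.ker_toZMod, RingHom.mem_ker]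
  simp [ZMod.pow_card]

lemma tendsto_inv_pow_succ : Tendsto (fun k : ℕ => (p : ℝ)⁻¹ ^ (k + 1)) atTop (𝓝 0) :=
  (tendsto_pow_atTop_nhds_zero_of_lt_one (by positivity) (inv_lt_one (p := p))).comp (tendsto_add_atTop_nat 1)

lemma tendsto_teich {x : ℚ_[p]} (hx : ‖x‖ ≤ 1) :
    Tendsto (fun n : ℕ => x ^ p ^ n) atTop (𝓝 (teich p x)) := by
  refine tendsto_nhds_limUnder (cauchySeq_tendsto_of_complete
    (NonarchimedeanAddGroup.cauchySeq_of_tendsto_sub_nhds_zero ?_))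
  refine squeeze_zero_norm (fun k => ?_) (tendsto_inv_pow_succ (p := p))
  rw [pow_succ', pow_mul]
  exact norm_pow_sub_pow_le (norm_pow_p_sub_lt_one (⟨x, hx⟩ : ℤ_[p])) k

lemma teich_congr {x y : ℚ_[p]} (hx : ‖x‖ ≤ 1) (hy : ‖y‖ ≤ 1) (h : ‖x - y‖ < 1) :
    teich p x = teich p y := by
  have h0 : Tendsto (fun n : ℕ => x ^ p ^ n - y ^ p ^ n) atTop (𝓝 0) :=
    squeeze_zero_norm (fun k => norm_pow_sub_pow_le (x := ⟨x, hx⟩) (y := ⟨y, hy⟩) h k)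
      tendsto_inv_pow_succ
  exact sub_eq_zero.mp
    (tendsto_nhds_unique ((tendsto_teich hx).sub (tendsto_teich hy)) h0)

lemma teich_one : teich p 1 = 1 := by
  have h := tendsto_teich (p := p) (x := 1) (by simp)
  simp only [one_pow] at h
  exact (tendsto_nhds_unique tendsto_const_nhds h).symm

lemma norm_teich_sub_lt_one {x : ℚ_[p]} (hx : ‖x‖ ≤ 1) : ‖teich p x - x‖ < 1 := by
  refine lt_of_le_of_lt ?_ (inv_lt_one (p := p))
  refine le_of_tendsto ((tendsto_teich hx).sub_const x).norm (Eventually.of_forall fun n => ?_)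
  refine norm_le_inv_of_lt_one ?_
  induction n with
  | zero => simp
  | succ n ih =>
    have h1 : ‖x ^ p ^ (n + 1) - x ^ p ^ n‖ < 1 := by
      have := norm_pow_p_sub_lt_one ((show ℤ_[p] from ⟨x, hx⟩) ^ p ^ n)
      rwa [← pow_mul, ← pow_succ] at this
    rw [← sub_add_sub_cancel _ (x ^ p ^ n)]
    exact (IsUltrametricDist.norm_add_le_max _ _).trans_lt (max_lt h1 ih)

lemma norm_eq_one_of_norm_sub_one_lt {y : ℚ_[p]} (h : ‖y - 1‖ < 1) : ‖y‖ = 1 := by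
  simpa using Padic.norm_eq_of_norm_sub_lt_right (z1 := y) (z2 := 1) (by simpa using h)

lemma norm_unitPart {x : ℚ_[p]} (hx : x ≠ 0) : ‖unitPart p x‖ = 1 := by
  have hp0 : (p : ℝ) ≠ 0 := by exact_mod_cast (Fact.out : p.Prime).ne_zero
  rw [unitPart, norm_mul, Padic.norm_p_zpow, Padic.norm_eq_zpow_neg_valuation hx, ← zpow_add₀ hp0]
  simp

lemma valuation_eq_of_norm_eq {x y : ℚ_[p]} (hx : x ≠ 0) (h : ‖x‖ = ‖y‖) :
    x.valuation = y.valuation := by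
  have hy : y ≠ 0 := norm_ne_zero_iff.mp (h ▸ norm_ne_zero_iff.mpr hx)
  rw [Padic.norm_eq_zpow_neg_valuation hx, Padic.norm_eq_zpow_neg_valuation hy] at h
  have hp1 : (1 : ℝ) < p := by exact_mod_cast (Fact.out : p.Prime).one_lt
  exact neg_injective (zpow_right_injective₀ (by linarith) hp1.ne' h)

lemma angle_eq_self {y : ℚ_[p]} (h : ‖y - 1‖ < 1) : angle p y = y := by
  have hy := norm_eq_one_of_norm_sub_one_lt h
  have hu : unitPart p y = y := by
    have hv : y.valuation = 0 := by
      simpa using valuation_eq_of_norm_eq (x := y) (y := 1)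
        (norm_ne_zero_iff.mp (by simp [hy])) (by simp [hy])
    simp [unitPart, hv]
  rw [angle, hu, teich_congr hy.le (by simp) h, teich_one, div_one]

lemma norm_angle_sub_one_lt {x : ℚ_[p]} (hx : x ≠ 0) : ‖angle p x - 1‖ < 1 := by
  have hu := norm_unitPart hx
  have h := norm_teich_sub_lt_one hu.le
  have ht : ‖teich p (unitPart p x)‖ = 1 :=
    (Padic.norm_eq_of_norm_sub_lt_right (hu.symm ▸ h)).trans hu
  have ht0 : teich p (unitPart p x) ≠ 0 := norm_ne_zero_iff.mp (by simp [ht])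
  rw [angle, div_sub_one ht0, norm_div, ht, div_one, norm_sub_rev]
  exact h

lemma inv_natCast_le_norm {n : ℕ} (hn : n ≠ 0) : (n : ℝ)⁻¹ ≤ ‖(n : ℚ_[p])‖ := by
  rw [Padic.norm_eq_zpow_neg_valuation (by exact_mod_cast hn), Padic.valuation_natCast, zpow_neg,
    zpow_natCast]
  have hp0 := (Fact.out : p.Prime).pos
  gcongr
  exact_mod_cast Nat.le_of_dvd (Nat.pos_of_ne_zero hn) pow_padicValNat_dvd

lemma norm_log_term_le {y : ℚ_[p]} (h : ‖y - 1‖ < 1) (n : ℕ) :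
    ‖(-1 : ℚ_[p]) ^ n * (y - 1) ^ (n + 1) / ((n : ℚ_[p]) + 1)‖
      ≤ ((n + 1 : ℕ) : ℝ) ^ 1 * (p : ℝ)⁻¹ ^ (n + 1) := by
  rw [norm_div, norm_mul, norm_pow, norm_neg, norm_one, one_pow, one_mul, norm_pow, mul_comm,
    ← Nat.cast_succ, pow_one, div_eq_mul_inv]
  gcongr
  · exact norm_le_inv_of_lt_one h
  · exact inv_le_of_inv_le₀ (by positivity) (inv_natCast_le_norm n.succ_ne_zero)

lemma summable_log_bound : Summable fun n : ℕ => ((n + 1 : ℕ) : ℝ) ^ 1 * (p : ℝ)⁻¹ ^ (n + 1) :=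
  (summable_nat_add_iff (f := fun n : ℕ => (n : ℝ) ^ 1 * (p : ℝ)⁻¹ ^ n) 1).mpr (summable_pow_mul_geometric_of_norm_lt_one 1
    (by rw [Real.norm_of_nonneg (by positivity)]; exact inv_lt_one))

lemma norm_padicLog_le {y : ℚ_[p]} (h : ‖y - 1‖ < 1) : ‖padicLog p y‖ ≤ (p : ℝ)⁻¹ := by
  rw [padicLog, angle_eq_self h]
  refine IsUltrametricDist.norm_tsum_le_of_forall_le fun n => (norm_log_term_le h n).trans ?_
  have h2 : 2 ≤ p := (Fact.out : p.Prime).two_le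
  have h1 : ((n + 1 : ℕ) : ℝ) ≤ (p : ℝ) ^ n := by
    exact_mod_cast (Nat.lt_pow_self (n := n) (a := p) (by omega))
  have hp0 : (0 : ℝ) < p := by positivity
  rw [pow_one, pow_succ, ← mul_assoc]
  refine mul_le_of_le_one_left (by positivity) ?_
  rw [inv_pow, ← div_eq_mul_inv, div_le_one (by positivity)]
  exact h1

lemma continuous_padicLog_comp {X : Type*} [TopologicalSpace X] {g : X → ℚ_[p]}
    (hg : Continuous g) (h : ∀ x, ‖g x - 1‖ < 1) : Continuous fun x => padicLog p (g x) := by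
  simp_rw [padicLog, fun x => angle_eq_self (h x)]
  exact continuous_tsum (fun n => by fun_prop) summable_log_bound
    fun n x => norm_log_term_le (h x) n

lemma norm_add_coe_eq {lam : ℚ_[p]} (hlam : 1 < ‖lam‖) (z : ℤ_[p]) : ‖lam + z‖ = ‖lam‖ := by
  refine Padic.norm_eq_of_norm_sub_lt_right ?_
  rw [add_sub_cancel_left]
  exact (PadicInt.norm_le_one z).trans_lt hlam

lemma angle_add_coe {lam : ℚ_[p]} (hlam : 1 < ‖lam‖) (z : ℤ_[p]) :
    angle p (lam + z)
      = (lam + z) * (p : ℚ_[p]) ^ (-lam.valuation) / teich p (unitPart p lam) := by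
  have hl0 : lam ≠ 0 := norm_ne_zero_iff.mp (by linarith)
  have hn := norm_add_coe_eq hlam z
  have hz0 : lam + z ≠ 0 := norm_ne_zero_iff.mp (by linarith)
  have hv := valuation_eq_of_norm_eq hz0 hn
  rw [angle, teich_congr (norm_unitPart hz0).le (norm_unitPart hl0).le, unitPart, hv]
  have h1 := norm_unitPart hl0
  rw [unitPart, norm_mul] at h1
  have h2 : 0 < ‖(p : ℚ_[p]) ^ (-lam.valuation)‖ :=
    (norm_nonneg _).lt_of_ne' fun h => by rw [h, mul_zero] at h1; exact zero_ne_one h1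
  rw [unitPart, unitPart, hv, ← sub_mul, add_sub_cancel_left, norm_mul]
  calc ‖(z : ℚ_[p])‖ * ‖(p : ℚ_[p]) ^ (-lam.valuation)‖
      < ‖lam‖ * ‖(p : ℚ_[p]) ^ (-lam.valuation)‖ :=
        mul_lt_mul_of_pos_right ((PadicInt.norm_le_one z).trans_lt hlam) h2
    _ = 1 := h1

lemma norm_pow_div_factorial_le {x : ℚ_[p]} (hx : ‖x‖ ≤ (p : ℝ)⁻¹) (k : ℕ) :
    ‖x ^ k / (k.factorial : ℚ_[p])‖ ≤ ((p : ℝ) ^ (((p : ℝ) - 2) / ((p : ℝ) - 1)))⁻¹ ^ k := by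
  have hp1 : (1 : ℝ) < p := by exact_mod_cast (Fact.out : p.Prime).one_lt
  have hp0 : (0 : ℝ) < p := by linarith
  have hv : ((p : ℝ) - 1) * padicValNat p k.factorial ≤ k := by
    have h : (p - 1) * padicValNat p k.factorial ≤ k :=
      (sub_one_mul_padicValNat_factorial k).le.trans (Nat.sub_le _ _)
    have h' : ((p - 1 : ℕ) : ℝ) * padicValNat p k.factorial ≤ k := by exact_mod_cast h
    rwa [Nat.cast_sub (Fact.out : p.Prime).one_lt.le, Nat.cast_one] at h'
  have hfac : (k.factorial : ℚ_[p]) ≠ 0 := by exact_mod_cast k.factorial_ne_zero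
  calc ‖x ^ k / (k.factorial : ℚ_[p])‖
      ≤ (p : ℝ)⁻¹ ^ k * (p : ℝ) ^ (padicValNat p k.factorial) := by
        rw [norm_div, norm_pow, Padic.norm_eq_zpow_neg_valuation hfac, Padic.valuation_natCast,
          zpow_neg, zpow_natCast, div_inv_eq_mul]
        gcongr
    _ = (p : ℝ) ^ (-(k : ℝ) + padicValNat p k.factorial) := by
        rw [Real.rpow_add hp0, Real.rpow_neg hp0.le, Real.rpow_natCast, Real.rpow_natCast, inv_pow]
    _ ≤ (p : ℝ) ^ (-(((p : ℝ) - 2) / ((p : ℝ) - 1)) * k) := by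
        refine Real.rpow_le_rpow_of_exponent_le hp1.le ?_
        have h1 : (0 : ℝ) < p - 1 := by linarith
        rw [← mul_le_mul_iff_right₀ h1]
        field_simp
        linarith
    _ = _ := by rw [Real.rpow_mul hp0.le, Real.rpow_neg hp0.le, Real.rpow_natCast]

lemma tsum_prod_eq_tsum_sum_antidiagonal {A : Type*} [AddCommGroup A] [UniformSpace A]
    [IsUniformAddGroup A] [CompleteSpace A] [T0Space A] {G : ℕ × ℕ → A} (hG : Summable G) :
    ∑' q, G q = ∑' n, ∑ q ∈ Finset.HasAntidiagonal.antidiagonal n, G q := by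
  let e := Finset.HasAntidiagonal.sigmaAntidiagonalEquivProd (A := ℕ)
  have hGe : Summable fun x => G (e x) := e.summable_iff.mpr hG
  calc ∑' q, G q = ∑' x, G (e x) := (e.tsum_eq G).symm
    _ = ∑' n, ∑' q : Finset.HasAntidiagonal.antidiagonal n, G (e ⟨n, q⟩) := hGe.tsum_sigma
    _ = _ := tsum_congr fun n =>
      (tsum_fintype _).trans (Finset.sum_coe_sort (Finset.HasAntidiagonal.antidiagonal n) G)

/-- Recentering a power series from `1` to `0` preserves its disc of convergence, provided
the radius is larger than `1`. -/
lemma exists_recentered_series {d : ℕ → ℚ_[p]} {r : ℝ} (hr0 : 0 ≤ r) (hr1 : r < 1)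
    (hd : ∀ k, ‖d k‖ ≤ r ^ k) :
    ∃ c : ℕ → ℚ_[p], ∀ s : ℚ_[p], ‖s‖ * r < 1 →
      Summable (fun n => c n * s ^ n) ∧ ∑' n, c n * s ^ n = ∑' k, d k * (1 - s) ^ k := by
  refine ⟨fun n => ∑' m, d (n + m) * ((n + m).choose n : ℚ_[p]) * (-1) ^ n, fun s hs => ?_⟩
  let G : ℕ × ℕ → ℚ_[p] := fun q =>
    d (q.1 + q.2) * ((q.1 + q.2).choose q.1 : ℚ_[p]) * (-1) ^ q.1 * s ^ q.1
  have hG : Summable G := by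
    have hgeo : Summable fun q : ℕ × ℕ => (‖s‖ * r) ^ q.1 * r ^ q.2 :=
      (summable_geometric_of_lt_one (by positivity) hs).mul_of_nonneg
        (summable_geometric_of_lt_one hr0 hr1) (fun _ => by positivity) (fun _ => by positivity)
    refine Summable.of_norm_bounded hgeo fun q => ?_
    simp only [G, norm_mul, norm_pow, norm_neg, norm_one, one_pow, mul_one]
    calc ‖d (q.1 + q.2)‖ * ‖((q.1 + q.2).choose q.1 : ℚ_[p])‖ * ‖s‖ ^ q.1
        ≤ r ^ (q.1 + q.2) * 1 * ‖s‖ ^ q.1 := by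
          gcongr
          · exact hd _
          · exact IsUltrametricDist.norm_natCast_le_one _ _
      _ = (‖s‖ * r) ^ q.1 * r ^ q.2 := by ring
  have hc : ∀ n, ∑' m, G (n, m)
      = (∑' m, d (n + m) * ((n + m).choose n : ℚ_[p]) * (-1) ^ n) * s ^ n :=
    fun n => by rw [← tsum_mul_right]
  refine ⟨hG.prod.congr fun n => hc n, ?_⟩
  simp_rw [← hc]
  rw [← hG.tsum_prod, tsum_prod_eq_tsum_sum_antidiagonal hG]
  refine tsum_congr fun k => ?_
  rw [sub_eq_neg_add, (Commute.all (-s) 1).add_pow', Finset.mul_sum]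
  refine Finset.sum_congr rfl fun q hq => ?_
  rw [Finset.HasAntidiagonal.mem_antidiagonal] at hq
  simp only [G, hq, one_pow, mul_one, nsmul_eq_mul, neg_pow s]
  ring

/-- The exponential series may be integrated term by term. -/
lemma tendsto_fermSum_tsum {L : ℤ_[p] → ℚ_[p]} {d : ℕ → ℚ_[p]} {r : ℝ} (hr0 : 0 ≤ r)
    (hL : ∀ k a, ‖L a ^ k / (k.factorial : ℚ_[p])‖ ≤ r ^ k)
    (hd : ∀ k, Tendsto (fermSum p fun a => L a ^ k / (k.factorial : ℚ_[p])) atTop (𝓝 (d k)))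
    {t : ℚ_[p]} (ht : ‖t‖ * r < 1) :
    Tendsto (fermSum p fun a => ∑' k : ℕ, (t * L a) ^ k / (k.factorial : ℚ_[p])) atTop
      (𝓝 (∑' k, d k * t ^ k)) := by
  have hbound : Summable fun k : ℕ => (‖t‖ * r) ^ k :=
    summable_geometric_of_lt_one (by positivity) ht
  have hterm : ∀ k a, ‖(t * L a) ^ k / (k.factorial : ℚ_[p])‖ ≤ (‖t‖ * r) ^ k := fun k a => by
    rw [mul_pow, mul_div_assoc, norm_mul, norm_pow, mul_pow]
    gcongr
    exact hL k a
  have hsum : (fermSum p fun a => ∑' k : ℕ, (t * L a) ^ k / (k.factorial : ℚ_[p]))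
      = fun N => ∑' k : ℕ, fermSum p (fun a => (t * L a) ^ k / (k.factorial : ℚ_[p])) N := by
    funext N
    simp only [fermSum]
    rw [Summable.tsum_finsetSum fun (a : ℕ) _ =>
      (Summable.of_norm_bounded hbound fun k => hterm k (a : ℤ_[p])).mul_left ((-1) ^ a)]
    exact Finset.sum_congr rfl fun a _ => tsum_mul_left.symm
  rw [hsum]
  refine tendsto_tsum_of_dominated_convergence hbound (fun k => ?_)
    (Eventually.of_forall fun N k => fermSum_norm_le (by positivity) (hterm k) N)
  convert (hd k).mul_const (t ^ k) using 2 with N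
  rw [fermSum, fermSum, Finset.sum_mul]
  exact Finset.sum_congr rfl fun a _ => by ring

lemma one_lt_radius (hp : Odd p) : 1 < (p : ℝ) ^ (((p : ℝ) - 2) / ((p : ℝ) - 1)) := by
  have hp3 : (3 : ℝ) ≤ p := by
    have h2 := (Fact.out : p.Prime).two_le
    obtain ⟨m, hm⟩ := hp
    exact_mod_cast (by omega : 3 ≤ p)
  exact Real.one_lt_rpow (by linarith) (div_pos (by linarith) (by linarith))

end PZeta

/-- for an odd prime `p`, continuous `f : ℤ_p → ℤ_p` and `‖λ‖ > 1`, there is a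
power series `Σ c_n s^n` converging for `‖s‖ < p^{(p-2)/(p-1)}` whose sum is the fermionic
integral `ζ_{p,E}^f(s,λ) = ∫_{ℤ_p} ⟨λ+f(a)⟩^{1-s} dμ₋₁(a)` (the power via the exponential
series); in particular `s ↦ ζ_{p,E}^f(s,λ)` is analytic on that disc. -/
theorem zetaE_analytic_in_s (p : ℕ) [Fact p.Prime] (hp : Odd p)
    (f : ℤ_[p] → ℤ_[p]) (hf : Continuous f) (lam : ℚ_[p]) (hlam : 1 < ‖lam‖) :
    ∃ c : ℕ → ℚ_[p], ∀ s : ℚ_[p], ‖s‖ < (p : ℝ) ^ (((p : ℝ) - 2) / ((p : ℝ) - 1)) →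
      Summable (fun n : ℕ => c n * s ^ n) ∧
      Filter.Tendsto
        (fermSum p fun a => epow p (angle p (lam + (f a : ℚ_[p]))) (1 - s))
        Filter.atTop (nhds (∑' n : ℕ, c n * s ^ n)) := by
  set R : ℝ := (p : ℝ) ^ (((p : ℝ) - 2) / ((p : ℝ) - 1))
  have hR1 : 1 < R := one_lt_radius hp
  have hR0 : 0 < R := by linarith
  have hangle : ∀ a, ‖angle p (lam + (f a : ℚ_[p])) - 1‖ < 1 := fun a =>
    norm_angle_sub_one_lt (norm_ne_zero_iff.mp (by rw [norm_add_coe_eq hlam]; linarith))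
  have hcont : Continuous fun a => angle p (lam + (f a : ℚ_[p])) := by
    simp_rw [angle_add_coe hlam]
    have : Continuous fun a => (f a : ℚ_[p]) := continuous_subtype_val.comp hf
    fun_prop
  set L : ℤ_[p] → ℚ_[p] := fun a => padicLog p (angle p (lam + (f a : ℚ_[p])))
  have hL : ∀ k a, ‖L a ^ k / (k.factorial : ℚ_[p])‖ ≤ R⁻¹ ^ k := fun k a =>
    norm_pow_div_factorial_le (norm_padicLog_le (hangle a)) k
  choose d hd using fun k : ℕ => exists_tendsto_fermSum hp
    (((continuous_padicLog_comp hcont hangle).pow k).div_const (k.factorial : ℚ_[p]))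
  have hd_le : ∀ k, ‖d k‖ ≤ R⁻¹ ^ k := fun k =>
    le_of_tendsto (hd k).norm
      (Eventually.of_forall fun N => fermSum_norm_le (by positivity) (hL k) N)
  obtain ⟨c, hc⟩ := exists_recentered_series (by positivity) (inv_lt_one_of_one_lt₀ hR1) hd_le
  refine ⟨c, fun s hs => ?_⟩
  have key : ∀ t : ℚ_[p], ‖t‖ < R → ‖t‖ * R⁻¹ < 1 := fun t ht => by
    rwa [← div_eq_mul_inv, div_lt_one hR0]
  have ht : ‖1 - s‖ < R := by
    rw [sub_eq_add_neg]
    exact (IsUltrametricDist.norm_add_le_max _ _).trans_lt (max_lt (by simpa) (by simpa))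
  obtain ⟨h1, h2⟩ := hc s (key s hs)
  refine ⟨h1, ?_⟩
  rw [h2]
  exact tendsto_fermSum_tsum (by positivity) hL hd (key _ ht)
end
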